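/- Let 𝐗 and 𝐘 be disjoint nonempty node sets in a DAG D. Then: (i) if 𝐗 ∩ forb(𝐗,𝐘,D) ≠ ∅, then no set disjoint from 𝐗 ∪ 𝐘 satisfies the adjustment criterion relative to (𝐗,𝐘) in D; (ii) if 𝐘 ⊆ De(𝐗,D), then 𝐗 ∩ forb(𝐗,𝐘,D) ≠ ∅ if and only if no set disjoint from 𝐗 ∪ 𝐘 satisfies the adjustment criterion relative to (𝐗,𝐘) in D. -/

import Mathlib

attribute [local instance] Classical.propDecidable

/-- A finite directed acyclic graph on vertex type `V`. -/
structure DAG (V : Type) [Fintype V] [DecidableEq V] where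
  /-- the edge relation: `Edge a b` means there is a directed edge `a → b` -/
  Edge : V → V → Prop
  /-- there are no directed cycles -/
  acyclic : ∀ v, ¬ Relation.TransGen Edge v v

namespace DAG

variable {V : Type} [Fintype V] [DecidableEq V]

/-- two nodes are adjacent if they are joined by an edge in either direction -/
def Adj (D : DAG V) (a b : V) : Prop := D.Edge a b ∨ D.Edge b a

/-- `p` is a path from `x` to `y`: a list of distinct nodes, consecutive ones adjacent,
starting at `x` and ending at `y`. -/
def IsPathFrom (D : DAG V) (p : List V) (x y : V) : Prop :=
  p.Nodup ∧ p.Chain' D.Adj ∧ p.head? = some x ∧ p.getLast? = some y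

/-- a causal (directed) path: all edges point forward -/
def IsCausal (D : DAG V) (p : List V) : Prop := p.Chain' D.Edge

/-- descendants of a set of nodes (every node is its own descendant) -/
def Desc (D : DAG V) (S : Set V) : Set V :=
  {v | ∃ w ∈ S, Relation.ReflTransGen D.Edge w v}

/-- ancestors of a set of nodes (every node is its own ancestor) -/
def Anc (D : DAG V) (S : Set V) : Set V :=
  {v | ∃ w ∈ S, Relation.ReflTransGen D.Edge v w}

/-- `w` is a collider on the path `p`: both edges of `p` at `w` point into `w` -/
def IsColliderOn (D : DAG V) (p : List V) (w : V) : Prop :=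
  ∃ a b, [a, w, b] <:+: p ∧ D.Edge a w ∧ D.Edge b w

/-- `w` is a non-collider on `p`: a non-endpoint node of `p` that is not a collider on `p` -/
def IsNonColliderOn (D : DAG V) (p : List V) (w : V) : Prop :=
  (∃ a b, [a, w, b] <:+: p) ∧ ¬ D.IsColliderOn p w

/-- `Z` blocks the path `p`: some non-collider on `p` is in `Z`, or some collider on `p`
has no descendant in `Z`.  Otherwise `p` is d-connecting given `Z`. -/
def Blocks (D : DAG V) (Z : Set V) (p : List V) : Prop :=
  (∃ w, D.IsNonColliderOn p w ∧ w ∈ Z) ∨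
  (∃ w, D.IsColliderOn p w ∧ D.Desc {w} ∩ Z = ∅)

/-- `p` is a proper causal path from `X` to `Y` -/
def ProperCausalPath (D : DAG V) (X Y : Set V) (p : List V) : Prop :=
  (∃ x ∈ X, ∃ y ∈ Y, D.IsPathFrom p x y) ∧ (∀ v ∈ p.tail, v ∉ X) ∧ D.IsCausal p

/-- `p` is a proper non-causal path from `X` to `Y` -/
def ProperNonCausalPath (D : DAG V) (X Y : Set V) (p : List V) : Prop :=
  (∃ x ∈ X, ∃ y ∈ Y, D.IsPathFrom p x y) ∧ (∀ v ∈ p.tail, v ∉ X) ∧ ¬ D.IsCausal p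

/-- the forbidden set: all descendants of nodes `W ∉ X` lying on a proper causal path
from `X` to `Y` -/
def Forb (D : DAG V) (X Y : Set V) : Set V :=
  {v | ∃ p w, D.ProperCausalPath X Y p ∧ w ∈ p ∧ w ∉ X ∧
    Relation.ReflTransGen D.Edge w v}

/-- the adjustment criterion of Shpitser et al. / van der Zander et al. -/
def SatisfiesAC (D : DAG V) (X Y Z : Set V) : Prop :=
  Z ∩ D.Forb X Y = ∅ ∧ ∀ p, D.ProperNonCausalPath X Y p → D.Blocks Z p

/-- the constructive set `Adjust(X,Y,D)` -/
def AdjustSet (D : DAG V) (X Y : Set V) : Set V :=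
  D.Anc (X ∪ Y) \ (X ∪ Y ∪ D.Forb X Y)

/-- `Z` d-separates `X` and `Y` in `D`: `Z` blocks every path from `X` to `Y` -/
def DSep (D : DAG V) (X Y Z : Set V) : Prop :=
  ∀ x ∈ X, ∀ y ∈ Y, ∀ p, D.IsPathFrom p x y → D.Blocks Z p

/-- `p` is a back-door path from `x`: its first edge points into `x` -/
def IsBackdoorFrom (D : DAG V) (p : List V) (x : V) : Prop :=
  ∃ b rest, p = x :: b :: rest ∧ D.Edge b x

/-- Pearl's back-door criterion -/
def BackdoorCriterion (D : DAG V) (X Y Z : Set V) : Prop :=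
  Z ∩ D.Desc X = ∅ ∧
  ∀ x ∈ X, ∀ y ∈ Y, ∀ p, D.IsPathFrom p x y → D.IsBackdoorFrom p x → D.Blocks Z p

/-- the generalized back-door criterion of Maathuis and Colombo -/
def GenBackdoorCriterion (D : DAG V) (X Y Z : Set V) : Prop :=
  Z ∩ D.Desc X = ∅ ∧
  ∀ x ∈ X, ∀ y ∈ Y, ∀ p, D.IsPathFrom p x y → D.IsBackdoorFrom p x →
    D.Blocks ((Z ∪ X) \ {x}) p

end DAG


namespace DAG

variable {V : Type} [Fintype V] [DecidableEq V]

theorem not_edge_of_edge (D : DAG V) {a b : V} (h : D.Edge a b) : ¬ D.Edge b a :=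
  fun h' => D.acyclic a ((Relation.TransGen.single h).tail h')

theorem mem_forb_of_reflTransGen (D : DAG V) {X Y : Set V} {a b : V} (ha : a ∈ D.Forb X Y)
    (h : Relation.ReflTransGen D.Edge a b) : b ∈ D.Forb X Y := by
  obtain ⟨p, w, hp, hw, hwX, hwa⟩ := ha
  exact ⟨p, w, hp, hw, hwX, hwa.trans h⟩

/-- an edge whose tail lies outside `X` -/
def EdgeOff (D : DAG V) (X : Set V) (a b : V) : Prop := D.Edge a b ∧ a ∉ X

theorem exists_isChain_of_reflTransGen {α : Type*} {r : α → α → Prop} {a b : α}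
    (h : Relation.ReflTransGen r a b) :
    ∃ l, (a :: l).IsChain r ∧ (a :: l).getLast? = some b := by
  induction h using Relation.ReflTransGen.head_induction_on with
  | refl => exact ⟨[], by simp, by simp⟩
  | head h _ ih =>
    obtain ⟨l, hl, hb⟩ := ih
    exact ⟨_ :: l, hl.cons_cons h, by simpa using hb⟩

theorem reflTransGen_getLast {α : Type*} {r : α → α → Prop} {a b : α} {l : List α}
    (hl : (a :: l).IsChain r) (hb : (a :: l).getLast? = some b) {v : α} (hv : v ∈ a :: l) :
    Relation.ReflTransGen r v b := by
  induction l generalizing a v with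
  | nil =>
    simp at hb hv
    subst hb hv
    exact .refl
  | cons c l ih =>
    rw [List.isChain_cons_cons] at hl
    have hb' : (c :: l).getLast? = some b := by simpa using hb
    rcases List.mem_cons.1 hv with rfl | hv
    · exact .head hl.1 (ih hl.2 hb' List.mem_cons_self)
    · exact ih hl.2 hb' hv

theorem transGen_of_mem_tail {α : Type*} {r : α → α → Prop} {a : α} {l : List α}
    (hl : (a :: l).IsChain r) {v : α} (hv : v ∈ l) : Relation.TransGen r a v := by
  induction l generalizing a with
  | nil => simp at hv
  | cons c l ih =>
    rw [List.isChain_cons_cons] at hl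
    rcases List.mem_cons.1 hv with rfl | hv
    · exact .single hl.1
    · exact .head hl.1 (ih hl.2 hv)

theorem nodup_of_isChain_edge (D : DAG V) {l : List V} (hl : l.IsChain D.Edge) : l.Nodup := by
  induction l with
  | nil => simp
  | cons a l ih =>
    exact List.nodup_cons.2
      ⟨fun h => D.acyclic a (transGen_of_mem_tail hl h), ih hl.of_cons⟩

theorem notMem_of_reflTransGen_edgeOff {D : DAG V} {X : Set V} {a b : V}
    (h : Relation.ReflTransGen (D.EdgeOff X) a b) (hb : b ∉ X) : a ∉ X := by
  rcases h.cases_head with rfl | ⟨c, hc, -⟩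
  exacts [hb, hc.2]

/-- a directed walk into `X` can be cut at its first node in `X` -/
theorem exists_reflTransGen_edgeOff (D : DAG V) {X : Set V} {a b : V}
    (h : Relation.ReflTransGen D.Edge a b) (hb : b ∈ X) :
    ∃ x ∈ X, Relation.ReflTransGen (D.EdgeOff X) a x := by
  induction h using Relation.ReflTransGen.head_induction_on with
  | refl => exact ⟨b, hb, .refl⟩
  | @head a c h _ ih =>
    by_cases ha : a ∈ X
    · exact ⟨a, ha, .refl⟩
    · obtain ⟨x, hx, hcx⟩ := ih
      exact ⟨x, hx, .head ⟨h, ha⟩ hcx⟩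

theorem isChain_edgeOff {D : DAG V} {X : Set V} {l : List V} (hl : l.IsChain D.Edge)
    (hX : ∀ v ∈ l, v ∉ X) : l.IsChain (D.EdgeOff X) := by
  induction l with
  | nil => simp
  | cons a l ih =>
    cases l with
    | nil => simp
    | cons b l =>
      rw [List.isChain_cons_cons] at hl ⊢
      exact ⟨⟨hl.1, hX a (by simp)⟩, ih hl.2 fun v hv => hX v (by simp [hv])⟩

theorem ProperCausalPath.reflTransGen_edgeOff {D : DAG V} {X Y : Set V} {p : List V}
    (hp : D.ProperCausalPath X Y p) {w : V} (hw : w ∈ p) (hwX : w ∉ X) :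
    ∃ y ∈ Y, Relation.ReflTransGen (D.EdgeOff X) w y := by
  obtain ⟨⟨x, hx, y, hy, -, -, hhead, hlast⟩, hX, hc⟩ := hp
  obtain ⟨s, t, rfl⟩ := List.append_of_mem hw
  have hc' : (w :: t).IsChain D.Edge := hc.suffix (List.suffix_append s _)
  have hl' : (w :: t).getLast? = some y := by
    simpa [List.getLast?_append] using hlast
  have ht : ∀ v ∈ w :: t, v ∉ X := by
    intro v hv
    rcases List.mem_cons.1 hv with rfl | hv
    · exact hwX
    · refine hX v ?_
      cases s <;> simp [hv]
  exact ⟨y, hy, reflTransGen_getLast (isChain_edgeOff hc' ht) hl' (by simp)⟩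

theorem not_collider_of_fork (D : DAG V) {m l : List V} {w : V}
    (hm : (m ++ [w]).IsChain (flip D.Edge)) (hl : (w :: l).IsChain D.Edge) (v : V) :
    ¬ D.IsColliderOn (m ++ w :: l) v := by
  rintro ⟨a, b, h, hav, hbv⟩
  induction m with
  | nil =>
    have := hl.infix h
    simp only [List.isChain_cons_cons] at this
    exact D.not_edge_of_edge this.2.1 hbv
  | cons c m ih =>
    rcases List.infix_cons_iff.1 h with h | h
    · obtain ⟨t, ht⟩ := h
      cases m with
      | nil =>
        simp [flip] at hm ht
        obtain ⟨rfl, rfl, -⟩ := ht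
        exact D.not_edge_of_edge hm hav
      | cons d m =>
        simp [flip] at hm ht
        obtain ⟨rfl, rfl, -⟩ := ht
        exact D.not_edge_of_edge hm.1 hav
    · exact ih hm.of_cons h

/-- the concatenation of a reversed directed path from `w` to `X` and a directed path from `w`
to `Y`, for a last possible branching node `w` -/
theorem exists_fork (D : DAG V) {X Y : Set V} (hXY : Disjoint X Y)
    (h : (X ∩ D.Forb X Y).Nonempty) :
    ∃ p, D.ProperNonCausalPath X Y p ∧ (∀ v ∈ p, v ∉ X → v ∈ D.Forb X Y) ∧
      ∀ v, ¬ D.IsColliderOn p v := by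
  let S : Set V := {w | w ∈ D.Forb X Y ∧
    (∃ x ∈ X, Relation.ReflTransGen (D.EdgeOff X) w x) ∧
    ∃ y ∈ Y, Relation.ReflTransGen (D.EdgeOff X) w y}
  have hS : S.Nonempty := by
    obtain ⟨x, hx, p, w, hp, hw, hwX, hwx⟩ := h
    exact ⟨w, ⟨p, w, hp, hw, hwX, .refl⟩, D.exists_reflTransGen_edgeOff hwx hx,
      hp.reflTransGen_edgeOff hw hwX⟩
  have : Std.Irrefl (flip (Relation.TransGen D.Edge)) := ⟨D.acyclic⟩
  have : IsTrans V (flip (Relation.TransGen D.Edge)) := ⟨fun _ _ _ h h' => h'.trans h⟩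
  obtain ⟨w, ⟨hwF, ⟨x, hx, hwx⟩, y, hy, hwy⟩, hmin⟩ :=
    (Finite.wellFounded_of_trans_of_irrefl (flip (Relation.TransGen D.Edge))).has_min S hS
  have hyX : y ∉ X := fun h => Set.disjoint_left.1 hXY h hy
  have hwX : w ∉ X := notMem_of_reflTransGen_edgeOff hwy hyX
  obtain ⟨l, hl, hlx⟩ := exists_isChain_of_reflTransGen hwx
  obtain ⟨r, hr, hry⟩ := exists_isChain_of_reflTransGen hwy
  have hlE : (w :: l).IsChain D.Edge := hl.imp fun _ _ h => h.1
  have hrE : (w :: r).IsChain D.Edge := hr.imp fun _ _ h => h.1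
  have hrX : ∀ v ∈ w :: r, v ∉ X := fun v hv =>
    notMem_of_reflTransGen_edgeOff (reflTransGen_getLast hr hry hv) hyX
  have hdisj : ∀ v ∈ l, v ∉ w :: r := by
    intro v hv hv'
    have hwv := transGen_of_mem_tail hlE hv
    exact hmin v ⟨D.mem_forb_of_reflTransGen hwF hwv.to_reflTransGen,
      ⟨x, hx, reflTransGen_getLast hl hlx (by simp [hv])⟩,
      ⟨y, hy, reflTransGen_getLast hr hry hv'⟩⟩ hwv
  have hrev : (l.reverse ++ [w]).IsChain (flip (D.EdgeOff X)) := by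
    rw [← List.reverse_cons]
    exact List.isChain_reverse.2 hl
  have hrevE : (l.reverse ++ [w]).IsChain (flip D.Edge) := hrev.imp fun _ _ h => h.1
  obtain ⟨m, hm⟩ : ∃ m, l.reverse = x :: m := by
    cases hl' : l.reverse with
    | nil =>
      simp at hl'
      simp [hl'] at hlx
      exact absurd hx (hlx ▸ hwX)
    | cons c m =>
      have : l = m.reverse ++ [c] := by simpa using congrArg List.reverse hl'
      simp [this, List.getLast?_cons] at hlx
      exact ⟨m, by rw [hlx]⟩
  have hmX : ∀ v ∈ m, v ∉ X := by
    intro v hv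
    rw [hm] at hrev
    obtain ⟨c, -, hc⟩ := Relation.TransGen.tail'_iff.1
      (transGen_of_mem_tail hrev (v := v) (by simp [hv]))
    exact hc.2
  have hnc := D.not_collider_of_fork hrevE hrE
  rw [hm] at hnc hrevE
  refine ⟨x :: m ++ w :: r, ⟨⟨x, hx, y, hy, ⟨?_, ?_, ?_, ?_⟩⟩, ?_, ?_⟩, ?_, hnc⟩
  · rw [← hm]
    refine List.nodup_append'.2 ⟨List.nodup_reverse.2 (D.nodup_of_isChain_edge hlE.of_cons),
      D.nodup_of_isChain_edge hrE, fun v hv => hdisj v (List.mem_reverse.1 hv)⟩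
  · change List.IsChain _ _
    exact List.isChain_split.2 ⟨hrevE.imp fun _ _ h => Or.inr h, hrE.imp fun _ _ h => Or.inl h⟩
  · simp
  · rw [List.getLast?_append, hry, Option.some_or]
  · intro v hv
    rcases List.mem_append.1 (show v ∈ m ++ w :: r from hv) with hv | hv
    exacts [hmX v hv, hrX v hv]
  · intro hc
    have hc' : (x :: m ++ w :: r).IsChain D.Edge := hc
    cases m with
    | nil =>
      simp [flip] at hrevE hc'
      exact D.not_edge_of_edge hrevE hc'.1
    | cons c m =>
      simp [flip] at hrevE hc'
      exact D.not_edge_of_edge hrevE.1 hc'.1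
  · intro v hv _
    refine D.mem_forb_of_reflTransGen hwF ?_
    rw [← hm] at hv
    have hv' : v = w ∨ v ∈ l ∨ v ∈ r := by
      simp at hv
      tauto
    rcases hv' with rfl | hv | hv
    · exact .refl
    · exact (transGen_of_mem_tail hlE hv).to_reflTransGen
    · exact (transGen_of_mem_tail hrE hv).to_reflTransGen

theorem not_satisfiesAC_of_inter_forb_nonempty (D : DAG V) {X Y Z : Set V}
    (hXY : Disjoint X Y) (h : (X ∩ D.Forb X Y).Nonempty) (hZ : Disjoint Z (X ∪ Y)) :
    ¬ D.SatisfiesAC X Y Z := by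
  rintro ⟨hZF, hblock⟩
  obtain ⟨p, hp, hF, hnc⟩ := D.exists_fork hXY h
  rcases hblock p hp with ⟨w, ⟨⟨a, b, hab⟩, -⟩, hwZ⟩ | ⟨w, hw, -⟩
  · have hwX : w ∉ X := fun hwX => Set.disjoint_left.1 hZ hwZ (Or.inl hwX)
    have : w ∈ Z ∩ D.Forb X Y := ⟨hwZ, hF w (hab.subset (by simp)) hwX⟩
    simp [hZF] at this
  · exact hnc w hw

/-- a directed walk from `X` to `y ∈ Y` leaves `X` for the last time along a proper causal path -/
theorem mem_forb_of_mem_desc (D : DAG V) {X Y : Set V} (hXY : Disjoint X Y) {y : V}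
    (hy : y ∈ Y) (h : y ∈ D.Desc X) : y ∈ D.Forb X Y := by
  have hyX : y ∉ X := fun h => Set.disjoint_left.1 hXY h hy
  obtain ⟨x, hx, hxy⟩ := h
  suffices H : ∀ a, Relation.ReflTransGen D.Edge a y →
      (∃ p, D.ProperCausalPath X Y p ∧ y ∈ p) ∨
      ∃ l, (a :: l).IsChain D.Edge ∧ (a :: l).getLast? = some y ∧ ∀ v ∈ a :: l, v ∉ X by
    rcases H x hxy with ⟨p, hp, hyp⟩ | ⟨l, -, -, hl⟩
    · exact ⟨p, y, hp, hyp, hyX, .refl⟩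
    · exact absurd hx (hl x (by simp))
  intro a ha
  induction ha using Relation.ReflTransGen.head_induction_on with
  | refl => exact Or.inr ⟨[], by simp, by simp, by simpa using hyX⟩
  | @head a c hac _ ih =>
    rcases ih with h | ⟨l, hl, hly, hlX⟩
    · exact Or.inl h
    have hc : (a :: c :: l).IsChain D.Edge := hl.cons_cons hac
    have hlast : (a :: c :: l).getLast? = some y := by simpa using hly
    by_cases haX : a ∈ X
    · exact Or.inl ⟨a :: c :: l, ⟨⟨a, haX, y, hy, D.nodup_of_isChain_edge hc,
        hc.imp fun _ _ h => Or.inl h, rfl, hlast⟩, hlX, hc⟩, List.mem_of_getLast? hlast⟩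
    · refine Or.inr ⟨c :: l, hc, hlast, fun v hv => ?_⟩
      rcases List.mem_cons.1 hv with rfl | hv
      exacts [haX, hlX v hv]

theorem triple_infix_unique {α : Type*} {p : List α} (hp : p.Nodup) {a b a' b' w : α}
    (h : [a, w, b] <:+: p) (h' : [a', w, b'] <:+: p) : a = a' ∧ b = b' := by
  obtain ⟨s, t, rfl⟩ := h
  obtain ⟨s', t', h'⟩ := h'
  have h₁ : (s ++ [a]) ++ w :: (b :: t) = (s' ++ [a']) ++ w :: (b' :: t') := by
    simpa using h'.symm
  have hn : ((s ++ [a]) ++ w :: (b :: t)).Nodup := by simpa using hp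
  have hn' := h₁ ▸ hn
  have hw : w ∉ s ++ [a] := fun h => (List.nodup_append'.1 hn).2.2 h (by simp)
  have hw' : w ∉ s' ++ [a'] := fun h => (List.nodup_append'.1 hn').2.2 h (by simp)
  obtain ⟨h₂, h₃⟩ : s ++ [a] = s' ++ [a'] ∧ b :: t = b' :: t' := by
    rw [List.append_eq_append_iff] at h₁
    rcases h₁ with ⟨u, hu, hu'⟩ | ⟨u, hu, hu'⟩
    · cases u with
      | nil => simp_all
      | cons c u => simp_all
    · cases u with
      | nil => simp_all
      | cons c u => simp_all
  simp at h₂ h₃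
  exact ⟨h₂.2, h₃.1⟩

theorem isChain_edge_of_no_collider (D : DAG V) {l : List V} {a b : V}
    (hl : (a :: b :: l).IsChain D.Adj) (hab : D.Edge a b)
    (hnc : ∀ v, ¬ D.IsColliderOn (a :: b :: l) v) : (a :: b :: l).IsChain D.Edge := by
  induction l generalizing a b with
  | nil => simpa using hab
  | cons c l ih =>
    rw [List.isChain_cons_cons] at hl ⊢
    have hbc : D.Edge b c := by
      rcases (List.isChain_cons_cons.1 hl.2).1 with h | h
      · exact h
      · exact absurd ⟨a, c, ⟨[], l, by simp⟩, hab, h⟩ (hnc b)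
    refine ⟨hab, ih hl.2 hbc ?_⟩
    rintro v ⟨d, e, h, hd, he⟩
    exact hnc v ⟨d, e, List.infix_cons h, hd, he⟩

theorem satisfiesAC_compl (D : DAG V) {X Y : Set V} (hYF : Y ⊆ D.Forb X Y)
    (hXF : Disjoint X (D.Forb X Y)) : D.SatisfiesAC X Y (X ∪ Y ∪ D.Forb X Y)ᶜ := by
  refine ⟨Set.disjoint_iff_inter_eq_empty.1
    (Set.disjoint_compl_left_iff_subset.2 Set.subset_union_right), ?_⟩
  rintro p ⟨⟨x, hx, y, hy, hnodup, hadj, hhead, hlast⟩, hX, hcausal⟩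
  by_contra hblock
  simp only [Blocks, not_or, not_exists, not_and] at hblock
  obtain ⟨hnon, hcol⟩ := hblock
  obtain ⟨p, rfl⟩ : ∃ q, p = x :: q := by
    cases p with
    | nil => simp at hhead
    | cons c q => exact ⟨q, by simpa using hhead⟩
  have hxy : x ≠ y := by
    rintro rfl
    exact Set.disjoint_left.1 hXF hx (hYF hy)
  have hnonF : ∀ w ∈ p, D.IsNonColliderOn (x :: p) w → w ∈ D.Forb X Y := by
    intro w hwp hw
    by_contra hwF
    refine hnon w hw ?_
    rintro ((h | h) | h)
    exacts [hX w hwp h, hwF (hYF h), hwF h]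
  have hcolF : ∀ w, D.IsColliderOn (x :: p) w → w ∉ D.Forb X Y := by
    intro w hw hwF
    refine hcol w hw (Set.eq_empty_of_forall_notMem ?_)
    rintro v ⟨⟨u, rfl, huv⟩, hv⟩
    exact hv (Or.inr (D.mem_forb_of_reflTransGen hwF huv))
  have hnc : ∀ w, ¬ D.IsColliderOn (x :: p) w := by
    intro w hw
    obtain ⟨a, d, had, -, hdw⟩ := id hw
    refine hcolF w hw (D.mem_forb_of_reflTransGen ?_ (.single hdw))
    obtain ⟨s, t, hst⟩ := id had
    have hdp : d ∈ p := by
      cases s <;> simp at hst <;> simp [← hst.2]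
    cases t with
    | nil =>
      rw [← hst] at hlast
      simp at hlast
      exact hYF (hlast ▸ hy)
    | cons e t =>
      have hwde : [w, d, e] <:+: x :: p := ⟨s ++ [a], t, by simpa using hst⟩
      refine hnonF d hdp ⟨⟨w, e, hwde⟩, ?_⟩
      rintro ⟨w', e', h', hw', -⟩
      obtain ⟨rfl, -⟩ := triple_infix_unique hnodup hwde h'
      exact D.not_edge_of_edge hdw hw'
  cases p with
  | nil => simp at hlast; exact hxy hlast
  | cons b l =>
    have hbF : b ∈ D.Forb X Y := by
      cases l with
      | nil =>
        simp at hlast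
        exact hYF (hlast ▸ hy)
      | cons c l =>
        exact hnonF b (by simp) ⟨⟨x, c, ⟨[], l, by simp⟩⟩, hnc b⟩
    have hadj' : (x :: b :: l).IsChain D.Adj := hadj
    refine hcausal (D.isChain_edge_of_no_collider hadj' ?_ hnc)
    rcases (List.isChain_cons_cons.1 hadj').1 with h | h
    · exact h
    · exact absurd (D.mem_forb_of_reflTransGen hbF (.single h)) (Set.disjoint_left.1 hXF hx)

/-- (i) If `X ∩ forb(X,Y,D) ≠ ∅` then no set disjoint from `X ∪ Y`
satisfies the adjustment criterion relative to `(X, Y)` in `D`; (ii) if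
`Y ⊆ De(X,D)`, then `X ∩ forb(X,Y,D) ≠ ∅` iff no set disjoint from `X ∪ Y` satisfies
the adjustment criterion relative to `(X, Y)` in `D`. -/
theorem exposures_in_forbidden_set
    (D : DAG V) (X Y : Set V)
    (hXY : Disjoint X Y) (hX : X.Nonempty) (hY : Y.Nonempty) :
    ((X ∩ D.Forb X Y ≠ ∅) →
        ¬ ∃ Z, Disjoint Z (X ∪ Y) ∧ D.SatisfiesAC X Y Z) ∧
    (Y ⊆ D.Desc X →
        ((X ∩ D.Forb X Y ≠ ∅) ↔
          ¬ ∃ Z, Disjoint Z (X ∪ Y) ∧ D.SatisfiesAC X Y Z)) := by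
  have hi : X ∩ D.Forb X Y ≠ ∅ → ¬ ∃ Z, Disjoint Z (X ∪ Y) ∧ D.SatisfiesAC X Y Z := by
    rintro h ⟨Z, hZ, hAC⟩
    exact D.not_satisfiesAC_of_inter_forb_nonempty hXY (Set.nonempty_iff_ne_empty.2 h) hZ hAC
  refine ⟨hi, fun hYX => ⟨hi, fun h hempty => h ⟨(X ∪ Y ∪ D.Forb X Y)ᶜ,
    Set.disjoint_compl_left_iff_subset.2 Set.subset_union_left,
    D.satisfiesAC_compl (fun y hy => D.mem_forb_of_mem_desc hXY hy (hYX hy))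
      (Set.disjoint_iff_inter_eq_empty.2 hempty)⟩⟩⟩

end DAG
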